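/- arXiv:1406.5586 — 3 statements merged into one kernel-verified Lean document; each statement's English description precedes it below -/
import Mathlib

section
/- Let Λ ⊆ ℍ be an axially symmetric s-domain, let 𝐢 ∈ 𝕊², and let Ω_𝐢 = {x + iy ∈ ℂ : x + y𝐢 ∈ Λ}. Let f : Λ → ℍ be slice regular on Λ. Then f satisfies the quaternionic C-property (f(conj q) = conj(f(q)) for all q ∈ Λ) if and only if there exists h : ℂ → ℂ holomorphic on Ω_𝐢 satisfying the C-property on Ω_𝐢 such that f(x + yI) = Re h(x+iy) + I·Im h(x+iy) for all x, y ∈ ℝ and I ∈ 𝕊² with x + yI ∈ Λ. -/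
open MeasureTheory Complex Quaternion

noncomputable section

/-- The sphere of imaginary units of the quaternions. -/
def Sph : Set ℍ[ℝ] := {I | I.re = 0 ∧ ‖I‖ = 1}

/-- `Λ ⊆ ℍ` is axially symmetric. -/
def AxSymm (Λ : Set ℍ[ℝ]) : Prop :=
  ∀ (x y : ℝ), (∃ J ∈ Sph, (x : ℍ[ℝ]) + y • J ∈ Λ) → ∀ I ∈ Sph, (x : ℍ[ℝ]) + y • I ∈ Λ

/-- The complex plane `ℂ(I) = {x + yI : x, y ∈ ℝ}` inside the quaternions. -/
def CSlice (I : ℍ[ℝ]) : Set ℍ[ℝ] := {q | ∃ x y : ℝ, q = (x : ℍ[ℝ]) + y • I}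

/-- `Λ` is an s-domain: an open connected set intersecting the real axis whose
intersection with each slice `ℂ(I)` is connected. -/
def IsSDomain (Λ : Set ℍ[ℝ]) : Prop :=
  IsOpen Λ ∧ IsConnected Λ ∧ (∃ r : ℝ, (r : ℍ[ℝ]) ∈ Λ) ∧
    ∀ I ∈ Sph, IsConnected (Λ ∩ CSlice I)

/-- `f` is (left) slice regular on `Λ`: it is real-differentiable on `Λ` and on each
slice it satisfies `∂f/∂x + I ∂f/∂y = 0`. -/
def SliceRegular (Λ : Set ℍ[ℝ]) (f : ℍ[ℝ] → ℍ[ℝ]) : Prop :=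
  DifferentiableOn ℝ f Λ ∧
  ∀ I ∈ Sph, ∀ x y : ℝ, (x : ℍ[ℝ]) + y • I ∈ Λ →
    deriv (fun t : ℝ => f ((t : ℍ[ℝ]) + y • I)) x
      + I * deriv (fun t : ℝ => f ((x : ℍ[ℝ]) + t • I)) y = 0

/-- The quaternionic C-property of a function on `Λ`. -/
def QCProp (Λ : Set ℍ[ℝ]) (f : ℍ[ℝ] → ℍ[ℝ]) : Prop :=
  ∀ q ∈ Λ, f (star q) = star (f q)

/-- The slice `Ω_𝐢 ⊆ ℂ` of `Λ` in the plane determined by `𝐢`. -/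
def SliceSet (Λ : Set ℍ[ℝ]) (i : ℍ[ℝ]) : Set ℂ :=
  {z | (z.re : ℍ[ℝ]) + z.im • i ∈ Λ}

/-- The embedding `ι : ℂ → ℂ(𝐢) ⊆ ℍ`, `a + b i ↦ a + b 𝐢`. -/
def toSlice (i : ℍ[ℝ]) (z : ℂ) : ℍ[ℝ] := (z.re : ℍ[ℝ]) + z.im • i

/-- `Ω` is invariant under complex conjugation. -/
def ZInvariant (Ω : Set ℂ) : Prop := ∀ z ∈ Ω, (starRingEnd ℂ) z ∈ Ω

/-- `f` is holomorphic on `Ω`: complex-differentiable at every point of `Ω`. -/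
def HolomorphicOn (Ω : Set ℂ) (f : ℂ → ℂ) : Prop := ∀ z ∈ Ω, DifferentiableAt ℂ f z

/-- `f` satisfies the C-property on `Ω`. -/
def CProp (Ω : Set ℂ) (f : ℂ → ℂ) : Prop := ∀ z ∈ Ω, f ((starRingEnd ℂ) z) = (starRingEnd ℂ) (f z)

/-- `f` satisfies the anti-C-property on `Ω`. -/
def AntiCProp (Ω : Set ℂ) (f : ℂ → ℂ) : Prop := ∀ z ∈ Ω, f ((starRingEnd ℂ) z) = -(starRingEnd ℂ) (f z)

theorem Sph.mul_self {I : ℍ[ℝ]} (hI : I ∈ Sph) : I * I = -1 := by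
  have h := sq_eq_neg_normSq.2 hI.1
  rw [normSq_eq_norm_mul_self, hI.2] at h
  simpa [sq] using h

theorem Sph.star_eq {I : ℍ[ℝ]} (hI : I ∈ Sph) : star I = -I := star_eq_neg.2 hI.1

theorem Sph.neg_mem {I : ℍ[ℝ]} (hI : I ∈ Sph) : -I ∈ Sph := ⟨by simp [hI.1], by simp [hI.2]⟩

/-- The embedding `ℂ → ℂ(I)` as a continuous real-linear map. -/
def toSliceCLM (I : ℍ[ℝ]) : ℂ →L[ℝ] ℍ[ℝ] :=
  Complex.reCLM.smulRight 1 + Complex.imCLM.smulRight I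

theorem coe_toSliceCLM (I : ℍ[ℝ]) : ⇑(toSliceCLM I) = toSlice I := by
  ext z <;> simp [toSliceCLM, toSlice]

/-- The real-linear map `q ↦ Re (p q) - Re (p I q) i`. For `I ∈ Sph` it intertwines left
multiplication by `I` with multiplication by `i`. -/
def sliceFunctional (I p : ℍ[ℝ]) : ℍ[ℝ] →L[ℝ] ℂ where
  toFun q := ((p * q).re : ℂ) - ((p * (I * q)).re : ℂ) * Complex.I
  map_add' a b := by
    simp only [mul_add, re_add, Complex.ofReal_add]; ring
  map_smul' r a := by
    simp only [mul_smul_comm, re_smul, smul_eq_mul, Complex.ofReal_mul, RingHom.id_apply,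
      Complex.real_smul]
    ring
  cont := by
    have := Quaternion.continuous_re
    fun_prop

theorem sliceFunctional_apply (I p q : ℍ[ℝ]) :
    sliceFunctional I p q = ((p * q).re : ℂ) - ((p * (I * q)).re : ℂ) * Complex.I := rfl

theorem sliceFunctional_mul {I : ℍ[ℝ]} (hI : I ∈ Sph) (p q : ℍ[ℝ]) :
    sliceFunctional I p (I * q) = Complex.I * sliceFunctional I p q := by
  rw [sliceFunctional_apply, sliceFunctional_apply, ← mul_assoc I I q, Sph.mul_self hI, neg_one_mul,
    mul_neg, re_neg, Complex.ofReal_neg]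
  linear_combination ((p * (I * q)).re : ℂ) * Complex.I_sq

theorem smul_one_eq_coe (r : ℝ) : r • (1 : ℍ[ℝ]) = r := by ext <;> simp

theorem sliceFunctional_coe (I p : ℍ[ℝ]) (r : ℝ) :
    sliceFunctional I p r = sliceFunctional I p 1 * r := by
  rw [← smul_one_eq_coe, map_smul, Complex.real_smul, mul_comm]

theorem sliceFunctional_toSlice {I : ℍ[ℝ]} (hI : I ∈ Sph) (p : ℍ[ℝ]) (z : ℂ) :
    sliceFunctional I p (toSlice I z) = sliceFunctional I p 1 * z := by
  have : z.im • I = I * (z.im : ℍ[ℝ]) := by rw [mul_coe_eq_smul]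
  rw [toSlice, map_add, this, sliceFunctional_mul hI, sliceFunctional_coe, sliceFunctional_coe]
  conv_rhs => rw [← Complex.re_add_im z]
  ring

theorem sliceFunctional_one_one {I : ℍ[ℝ]} (hI : I ∈ Sph) : sliceFunctional I 1 1 = 1 := by
  simp [sliceFunctional_apply, hI.1]

theorem eq_of_sliceFunctional_eq {I a b : ℍ[ℝ]}
    (h : ∀ p, sliceFunctional I p a = sliceFunctional I p b) : a = b := by
  rw [← sub_eq_zero]
  have h' := congrArg Complex.re (h (star (a - b)))
  simp only [sliceFunctional_apply, Complex.sub_re, Complex.ofReal_re, Complex.mul_re,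
    Complex.I_re, Complex.ofReal_im, mul_zero, zero_mul, sub_zero] at h'
  rw [← Quaternion.normSq_eq_zero]
  rw [← sub_eq_zero, ← re_sub, ← mul_sub, star_mul_self, re_coe] at h'
  exact h'

theorem AxSymm.sliceSet_eq {Λ : Set ℍ[ℝ]} (hax : AxSymm Λ) {I J : ℍ[ℝ]} (hI : I ∈ Sph)
    (hJ : J ∈ Sph) : SliceSet Λ I = SliceSet Λ J :=
  Set.ext fun _ => ⟨fun h => hax _ _ ⟨I, hI, h⟩ J hJ, fun h => hax _ _ ⟨J, hJ, h⟩ I hI⟩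

theorem star_slice {I : ℍ[ℝ]} (hI : I ∈ Sph) (x y : ℝ) :
    star ((x : ℍ[ℝ]) + y • I) = (x : ℍ[ℝ]) + (-y) • I := by
  simp [Sph.star_eq hI]

theorem AxSymm.star_mem {Λ : Set ℍ[ℝ]} (hax : AxSymm Λ) {I : ℍ[ℝ]} (hI : I ∈ Sph) {x y : ℝ}
    (h : (x : ℍ[ℝ]) + y • I ∈ Λ) : (x : ℍ[ℝ]) + (-y) • I ∈ Λ := by
  simpa using hax x y ⟨I, hI, h⟩ (-I) (Sph.neg_mem hI)

theorem sliceSet_eq_preimage (Λ : Set ℍ[ℝ]) (I : ℍ[ℝ]) :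
    SliceSet Λ I = toSliceCLM I ⁻¹' Λ := by
  rw [coe_toSliceCLM]; rfl

theorem isOpen_sliceSet {Λ : Set ℍ[ℝ]} (hΛ : IsOpen Λ) (I : ℍ[ℝ]) : IsOpen (SliceSet Λ I) := by
  rw [sliceSet_eq_preimage]
  exact hΛ.preimage (toSliceCLM I).continuous

theorem isPreconnected_sliceSet {Λ : Set ℍ[ℝ]} {I : ℍ[ℝ]} (hI : I ∈ Sph)
    (h : IsPreconnected (Λ ∩ CSlice I)) : IsPreconnected (SliceSet Λ I) := by
  have key (z : ℂ) : sliceFunctional I 1 (toSlice I z) = z := by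
    rw [sliceFunctional_toSlice hI, sliceFunctional_one_one hI, one_mul]
  convert h.image (sliceFunctional I 1) (sliceFunctional I 1).continuous.continuousOn using 1
  ext z
  constructor
  · exact fun hz => ⟨toSlice I z, ⟨hz, z.re, z.im, rfl⟩, key z⟩
  · rintro ⟨_, ⟨hq, x, y, rfl⟩, rfl⟩
    have := key ⟨x, y⟩
    rw [toSlice] at this
    rw [this]
    exact hq

/-- The components of a slice regular function on a slice are holomorphic. -/
theorem SliceRegular.differentiableAt {Λ : Set ℍ[ℝ]} (hΛ : IsOpen Λ) {f : ℍ[ℝ] → ℍ[ℝ]}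
    (hf : SliceRegular Λ f) {I : ℍ[ℝ]} (hI : I ∈ Sph) (p : ℍ[ℝ]) {z : ℂ}
    (hz : z ∈ SliceSet Λ I) :
    DifferentiableAt ℂ (fun w => sliceFunctional I p (f (toSlice I w))) z := by
  have hfz : HasFDerivAt f (fderiv ℝ f (toSlice I z)) (toSlice I z) :=
    (hf.1.differentiableAt (hΛ.mem_nhds hz)).hasFDerivAt
  set L := fderiv ℝ f (toSlice I z)
  have hs : HasFDerivAt (toSlice I) (toSliceCLM I) z := by
    rw [← coe_toSliceCLM]
    exact (toSliceCLM I).hasFDerivAt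
  have hcomp := ((sliceFunctional I p).hasFDerivAt).comp z (hfz.comp z hs)
  have hx : HasDerivAt (fun t : ℝ => (t : ℍ[ℝ]) + z.im • I) 1 z.re := by
    have h : HasDerivAt (fun t : ℝ => t • (1 : ℍ[ℝ]) + z.im • I) ((1 : ℝ) • 1) z.re :=
      ((hasDerivAt_id z.re).smul_const _).add_const _
    simpa only [smul_one_eq_coe, one_smul] using! h
  have hy : HasDerivAt (fun t : ℝ => (z.re : ℍ[ℝ]) + t • I) I z.im := by
    simpa using! ((hasDerivAt_id z.im).smul_const I).const_add (z.re : ℍ[ℝ])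
  have hCR := hf.2 I hI z.re z.im hz
  have h1 : HasDerivAt (fun t : ℝ => f ((t : ℍ[ℝ]) + z.im • I)) (L 1) z.re :=
    HasFDerivAt.comp_hasDerivAt z.re hfz hx
  have h2 : HasDerivAt (fun t : ℝ => f ((z.re : ℍ[ℝ]) + t • I)) (L I) z.im :=
    HasFDerivAt.comp_hasDerivAt z.im hfz hy
  rw [h1.deriv, h2.deriv] at hCR
  have hL : L I = I * L 1 := by
    rw [eq_neg_of_add_eq_zero_left hCR, mul_neg, ← mul_assoc, Sph.mul_self hI]
    simp
  refine differentiableAt_complex_iff_differentiableAt_real.2 ⟨hcomp.differentiableAt, ?_⟩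
  have e := hcomp.fderiv
  simp only [Function.comp_def] at e
  rw [e]
  simp [coe_toSliceCLM, toSlice, hL, sliceFunctional_mul hI]

theorem frequently_real (r : ℝ) : ∃ᶠ z in nhdsWithin (r : ℂ) {(r : ℂ)}ᶜ, z.im = 0 := by
  have ht : Filter.Tendsto ((↑) : ℝ → ℂ) (nhdsWithin r {r}ᶜ) (nhdsWithin (r : ℂ) {(r : ℂ)}ᶜ) :=
    Complex.continuous_ofReal.continuousWithinAt.tendsto_nhdsWithin fun x hx => by simpa using hx
  exact ht.frequently (Filter.Eventually.of_forall fun x => Complex.ofReal_im x).frequently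

theorem QCProp.apply_toSlice {Λ : Set ℍ[ℝ]} (hs : IsSDomain Λ) (hax : AxSymm Λ)
    {f : ℍ[ℝ] → ℍ[ℝ]} (hf : SliceRegular Λ f) (hq : QCProp Λ f) {i I : ℍ[ℝ]} (hi : i ∈ Sph)
    (hI : I ∈ Sph) {z : ℂ} (hz : z ∈ SliceSet Λ I) :
    f (toSlice I z) = toSlice I (sliceFunctional i 1 (f (toSlice i z))) := by
  obtain ⟨hΛ, -, ⟨r, hr⟩, hconn⟩ := hs
  have hopen := isOpen_sliceSet hΛ I
  refine eq_of_sliceFunctional_eq (I := I) fun p => ?_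
  rw [sliceFunctional_toSlice hI]
  have hrI : (r : ℂ) ∈ SliceSet Λ I := by simpa [SliceSet] using hr
  have hg : DifferentiableOn ℂ (fun w => sliceFunctional I p (f (toSlice I w))) (SliceSet Λ I) :=
    fun w hw => (hf.differentiableAt hΛ hI p hw).differentiableWithinAt
  have hh : DifferentiableOn ℂ (fun w => sliceFunctional I p 1 *
      sliceFunctional i 1 (f (toSlice i w))) (SliceSet Λ I) := fun w hw =>
    ((hf.differentiableAt hΛ hi 1 (hax.sliceSet_eq hI hi ▸ hw)).const_mul _).differentiableWithinAt
  refine (hg.analyticOnNhd hopen).eqOn_of_preconnected_of_frequently_eq (hh.analyticOnNhd hopen)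
    (isPreconnected_sliceSet hI (hconn I hI).isPreconnected) hrI ?_ hz
  refine ((frequently_real r).and_eventually
    (mem_nhdsWithin_of_mem_nhds (hopen.mem_nhds hrI))).mono ?_
  rintro w ⟨hw, hwΛ⟩
  have hw' (J : ℍ[ℝ]) : toSlice J w = (w.re : ℍ[ℝ]) := by simp [toSlice, hw]
  have hmem : (w.re : ℍ[ℝ]) ∈ Λ := hw' I ▸ hwΛ
  have hreal : f (w.re : ℍ[ℝ]) = ((f (w.re : ℍ[ℝ])).re : ℍ[ℝ]) :=
    star_eq_self.1 (by simpa using (hq _ hmem).symm)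
  simp only [hw']
  rw [hreal, sliceFunctional_coe, sliceFunctional_coe i, sliceFunctional_one_one hi, one_mul]

theorem stmt14 (Λ : Set ℍ[ℝ]) (hs : IsSDomain Λ) (hax : AxSymm Λ)
    (i : ℍ[ℝ]) (hi : i ∈ Sph)
    (f : ℍ[ℝ] → ℍ[ℝ]) (hf : SliceRegular Λ f) :
    QCProp Λ f ↔
      ∃ h : ℂ → ℂ, HolomorphicOn (SliceSet Λ i) h ∧ CProp (SliceSet Λ i) h ∧
        ∀ (x y : ℝ), ∀ I ∈ Sph, (x : ℍ[ℝ]) + y • I ∈ Λ →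
          f ((x : ℍ[ℝ]) + y • I) =
            ((h ((x : ℂ) + (y : ℝ) * Complex.I)).re : ℍ[ℝ])
              + (h ((x : ℂ) + (y : ℝ) * Complex.I)).im • I := by
  have hrep (x y : ℝ) : (x : ℂ) + (y : ℝ) * Complex.I = ⟨x, y⟩ := by
    apply Complex.ext <;> simp
  constructor
  · intro hq
    refine ⟨fun z => sliceFunctional i 1 (f (toSlice i z)),
      fun z hz => hf.differentiableAt hs.1 hi 1 hz, fun z hz => ?_, fun x y I hI h => ?_⟩
    · have hT := hq.apply_toSlice hs hax hf hi hi hz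
      have hc (w : ℂ) : star (toSlice i w) = toSlice i ((starRingEnd ℂ) w) := by
        simp [toSlice, Sph.star_eq hi]
      dsimp only
      rw [← hc, hq (toSlice i z) hz]
      conv_lhs => rw [hT, hc, sliceFunctional_toSlice hi, sliceFunctional_one_one hi, one_mul]
    · rw [hrep]
      exact hq.apply_toSlice hs hax hf hi hI (z := ⟨x, y⟩) h
  · rintro ⟨h, -, hc, hfh⟩ q hq
    obtain ⟨x, y, I, hI, rfl⟩ : ∃ (x y : ℝ) (I : ℍ[ℝ]), I ∈ Sph ∧ q = (x : ℍ[ℝ]) + y • I := by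
      by_cases him : q.im = 0
      · exact ⟨q.re, 0, i, hi, by simpa [him] using q.re_add_im.symm⟩
      · have hn : ‖q.im‖ ≠ 0 := norm_ne_zero_iff.2 him
        refine ⟨q.re, ‖q.im‖, ‖q.im‖⁻¹ • q.im, ⟨by simp, by simp [norm_smul, hn]⟩, ?_⟩
        rw [smul_smul, mul_inv_cancel₀ hn, one_smul, Quaternion.re_add_im]
    have hz : (⟨x, y⟩ : ℂ) ∈ SliceSet Λ i := hax x y ⟨I, hI, hq⟩ i hi
    have hcz := hc _ hz
    rw [show (starRingEnd ℂ) (⟨x, y⟩ : ℂ) = ⟨x, -y⟩ from rfl] at hcz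
    rw [star_slice hI, hfh x (-y) I hI (hax.star_mem hI hq), hfh x y I hI hq, star_slice hI,
      hrep, hrep, hcz]
    simp
end
end

section
/- (Refined Splitting Lemma) Let Λ ⊆ ℍ be an axially symmetric s-domain, let 𝐢, 𝐣 ∈ 𝕊² with 𝐢 ⊥ 𝐣 (i.e. 𝐢𝐣 = −𝐣𝐢), let Ω_𝐢 = {x + iy ∈ ℂ : x + y𝐢 ∈ Λ}, and let f : Λ → ℍ be slice regular on Λ. Then there exist four functions h₀, h₁, h₂, h₃ : ℂ → ℂ, each holomorphic on Ω_𝐢 and satisfying the C-property on Ω_𝐢, such that for all x + iy ∈ Ω_𝐢: f(x + y𝐢) = ι(h₀(x+iy)) + ι(h₁(x+iy))·𝐢 + ι(h₂(x+iy))·𝐣 + ι(h₃(x+iy))·𝐢𝐣, where ι(a + bi) := a + b𝐢 ∈ ℍ for a, b ∈ ℝ. -/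
open MeasureTheory Complex Quaternion

noncomputable section

/-- The `ℂ(i)`-component of a quaternion, read as a complex number. -/
def sliceComponent (i : ℍ[ℝ]) : ℍ[ℝ] →ₗ[ℝ] ℂ where
  toFun q := ⟨q.re, -(i * q).re⟩
  map_add' p q := by
    apply Complex.ext <;> simp [mul_add]
    ring
  map_smul' c q := by
    apply Complex.ext <;> simp
    ring

lemma sq_add_sq_add_sq_of_mem_Sph {i : ℍ[ℝ]} (hi : i ∈ Sph) :
    i.imI ^ 2 + i.imJ ^ 2 + i.imK ^ 2 = 1 := by
  have h := Quaternion.normSq_eq_norm_mul_self i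
  rw [hi.2, Quaternion.normSq_def', hi.1] at h
  linarith

lemma mul_self_of_mem_Sph {i : ℍ[ℝ]} (hi : i ∈ Sph) : i * i = -1 := by
  have h0 : i.re = 0 := hi.1
  have h1 := sq_add_sq_add_sq_of_mem_Sph hi
  ext <;> simp [h0] <;> linarith

lemma sliceComponent_mul {i : ℍ[ℝ]} (hi : i ∈ Sph) (q : ℍ[ℝ]) :
    sliceComponent i (i * q) = I * sliceComponent i q := by
  have h : i * (i * q) = -q := by rw [← mul_assoc, mul_self_of_mem_Sph hi, neg_one_mul]
  apply Complex.ext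
  · simp [sliceComponent]
  · simp only [sliceComponent, LinearMap.coe_mk, AddHom.coe_mk, h]
    simp

lemma toSlice_add (i : ℍ[ℝ]) (z w : ℂ) : toSlice i (z + w) = toSlice i z + toSlice i w := by
  ext <;> simp [toSlice] <;> ring

lemma toSlice_I_mul {i : ℍ[ℝ]} (hi : i ∈ Sph) (z : ℂ) :
    toSlice i (I * z) = toSlice i z * i := by
  simp only [toSlice, add_mul, smul_mul_assoc, mul_self_of_mem_Sph hi]
  ext <;> simp [add_comm]

/-- The splitting `ℍ = ℂ(i) ⊕ ℂ(i) j` for orthogonal imaginary units `i`, `j`. -/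
lemma toSlice_sliceComponent_add {i j : ℍ[ℝ]} (hi : i ∈ Sph) (hj : j ∈ Sph)
    (hperp : i * j = -(j * i)) (q : ℍ[ℝ]) :
    toSlice i (sliceComponent i q) + toSlice i (sliceComponent i (-(q * j))) * j = q := by
  have hi0 : i.re = 0 := hi.1
  have hj0 : j.re = 0 := hj.1
  have hi1 := sq_add_sq_add_sq_of_mem_Sph hi
  have hj1 := sq_add_sq_add_sq_of_mem_Sph hj
  have hij : i.imI * j.imI + i.imJ * j.imJ + i.imK * j.imK = 0 := by
    have h := congrArg QuaternionAlgebra.re hperp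
    simp [hi0, hj0] at h
    linarith
  let A : Matrix (Fin 3) (Fin 3) ℝ :=
    !![i.imI, i.imJ, i.imK; j.imI, j.imJ, j.imK;
      i.imJ * j.imK - i.imK * j.imJ,
      i.imK * j.imI - i.imI * j.imK, i.imI * j.imJ - i.imJ * j.imI]
  have hA : A * A.transpose = 1 := by
    ext a b
    fin_cases a <;> fin_cases b <;>
      simp [A, Matrix.mul_apply, Fin.sum_univ_three]
    · linarith
    · linarith
    · ring
    · linarith
    · linarith
    · ring
    · ring
    · ring
    · linear_combination (j.imI ^ 2 + j.imJ ^ 2 + j.imK ^ 2) * hi1 + hj1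
        - (i.imI * j.imI + i.imJ * j.imJ + i.imK * j.imK) * hij
  have hA' : A.transpose * A = 1 := mul_eq_one_comm.mp hA
  have h (a b : Fin 3) := congrFun (congrFun hA' a) b
  have h11 := h 0 0
  have h12 := h 0 1
  have h13 := h 0 2
  have h22 := h 1 1
  have h23 := h 1 2
  have h33 := h 2 2
  simp [A, Matrix.mul_apply, Fin.sum_univ_three] at h11 h12 h13 h22 h23 h33
  ext <;> simp [toSlice, sliceComponent, hi0, hj0]
  · linear_combination (q.re * (i.imI * j.imI + i.imJ * j.imJ + i.imK * j.imK) -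
      q.imI * (i.imJ * j.imK - i.imK * j.imJ) - q.imJ * (i.imK * j.imI - i.imI * j.imK) -
      q.imK * (i.imI * j.imJ - i.imJ * j.imI)) * hij
  · linear_combination q.imI * h11 + q.imJ * h12 + q.imK * h13 -
      q.re * (i.imJ * j.imK - i.imK * j.imJ) * hij
  · linear_combination q.imI * h12 + q.imJ * h22 + q.imK * h23 -
      q.re * (i.imK * j.imI - i.imI * j.imK) * hij
  · linear_combination q.imI * h13 + q.imJ * h23 + q.imK * h33 -
      q.re * (i.imI * j.imJ - i.imJ * j.imI) * hij

/-- If `L` turns left multiplication by `i` into multiplication by `I`, then `L ∘ f` is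
holomorphic on the slice `ℂ(i)`. -/
lemma SliceRegular.holomorphicOn_comp {Λ : Set ℍ[ℝ]} {f : ℍ[ℝ] → ℍ[ℝ]} (hΛ : IsOpen Λ)
    (hf : SliceRegular Λ f) {i : ℍ[ℝ]} (hi : i ∈ Sph) (L : ℍ[ℝ] →ₗ[ℝ] ℂ)
    (hL : ∀ q, L (i * q) = I * L q) :
    HolomorphicOn (SliceSet Λ i) (fun z => L (f (toSlice i z))) := by
  intro z hz
  have hd : HasFDerivAt f (fderiv ℝ f (toSlice i z)) (toSlice i z) :=
    (hf.1.differentiableAt (hΛ.mem_nhds hz)).hasFDerivAt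
  have hx : HasDerivAt (fun t : ℝ => (t : ℍ[ℝ]) + z.im • i) 1 z.re := by
    have h := ((hasDerivAt_id z.re).smul_const (1 : ℍ[ℝ])).add_const (z.im • i)
    simpa [← Algebra.algebraMap_eq_smul_one, Quaternion.algebraMap_def] using h
  have hy : HasDerivAt (fun t : ℝ => (z.re : ℍ[ℝ]) + t • i) i z.im := by
    simpa using ((hasDerivAt_id z.im).smul_const i).const_add (z.re : ℍ[ℝ])
  have hcr := hf.2 i hi z.re z.im hz
  have hfx : HasDerivAt (fun t : ℝ => f ((t : ℍ[ℝ]) + z.im • i))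
      (fderiv ℝ f (toSlice i z) 1) z.re := hd.comp_hasDerivAt z.re hx
  have hfy : HasDerivAt (fun t : ℝ => f ((z.re : ℍ[ℝ]) + t • i))
      (fderiv ℝ f (toSlice i z) i) z.im := hd.comp_hasDerivAt z.im hy
  rw [hfx.deriv, hfy.deriv] at hcr
  have hDi : fderiv ℝ f (toSlice i z) i = i * fderiv ℝ f (toSlice i z) 1 := by
    rw [eq_neg_of_add_eq_zero_left hcr, mul_neg, ← mul_assoc, mul_self_of_mem_Sph hi]
    simp
  let S : ℂ →ₗ[ℝ] ℍ[ℝ] :=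
    { toFun := toSlice i
      map_add' := toSlice_add i
      map_smul' := fun c w => by ext <;> simp [toSlice] <;> ring }
  have hS : HasFDerivAt (toSlice i) (LinearMap.toContinuousLinearMap S) z :=
    (LinearMap.toContinuousLinearMap S).hasFDerivAt
  have hg := (LinearMap.toContinuousLinearMap L).hasFDerivAt.comp z (hd.comp z hS)
  change HasFDerivAt (fun z => L (f (toSlice i z))) _ z at hg
  rw [differentiableAt_complex_iff_differentiableAt_real]
  refine ⟨hg.differentiableAt, ?_⟩
  have hSI : toSlice i I = i := by simp [toSlice]
  have hS1 : toSlice i 1 = 1 := by simp [toSlice]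
  rw [hg.fderiv]
  simp [S, hSI, hS1, hDi, hL]

/-- A holomorphic function on a conjugation-invariant set splits as `h + k I` with `h`, `k`
holomorphic and satisfying the C-property. -/
lemma HolomorphicOn.exists_cProp_add {Ω : Set ℂ} (hΩ : ZInvariant Ω) {F : ℂ → ℂ}
    (hF : HolomorphicOn Ω F) :
    ∃ h k : ℂ → ℂ, (HolomorphicOn Ω h ∧ CProp Ω h) ∧ (HolomorphicOn Ω k ∧ CProp Ω k) ∧
      ∀ z, F z = h z + I * k z := by
  have hG : HolomorphicOn Ω (fun z => (starRingEnd ℂ) (F ((starRingEnd ℂ) z))) := fun z hz =>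
    differentiableAt_conj_conj_iff.mpr (hF _ (hΩ z hz))
  refine ⟨fun z => (F z + (starRingEnd ℂ) (F ((starRingEnd ℂ) z))) / 2,
    fun z => -I * (F z - (starRingEnd ℂ) (F ((starRingEnd ℂ) z))) / 2,
    ⟨fun z hz => ((hF z hz).add (hG z hz)).div_const 2, fun z _ => ?_⟩,
    ⟨fun z hz => (((hF z hz).sub (hG z hz)).const_mul (-I)).div_const 2, fun z _ => ?_⟩,
    fun z => ?_⟩
  · simp [add_comm, Complex.conj_ofNat]
  · simp [Complex.conj_ofNat]
    ring
  · linear_combination (F z - (starRingEnd ℂ) (F ((starRingEnd ℂ) z))) / 2 * I_mul_I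

lemma AxSymm.zInvariant_sliceSet {Λ : Set ℍ[ℝ]} (hax : AxSymm Λ) {i : ℍ[ℝ]} (hi : i ∈ Sph) :
    ZInvariant (SliceSet Λ i) := by
  intro z hz
  have h := hax z.re z.im ⟨i, hi, hz⟩ (-i) ⟨by simp [hi.1], by simp [hi.2]⟩
  simpa [SliceSet] using h

/-- **Refined Splitting Lemma.** -/
theorem stmt15 (Λ : Set ℍ[ℝ]) (hs : IsSDomain Λ) (hax : AxSymm Λ)
    (i j : ℍ[ℝ]) (hi : i ∈ Sph) (hj : j ∈ Sph) (hperp : i * j = -(j * i))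
    (f : ℍ[ℝ] → ℍ[ℝ]) (hf : SliceRegular Λ f) :
    ∃ h₀ h₁ h₂ h₃ : ℂ → ℂ,
      (HolomorphicOn (SliceSet Λ i) h₀ ∧ CProp (SliceSet Λ i) h₀) ∧
      (HolomorphicOn (SliceSet Λ i) h₁ ∧ CProp (SliceSet Λ i) h₁) ∧
      (HolomorphicOn (SliceSet Λ i) h₂ ∧ CProp (SliceSet Λ i) h₂) ∧
      (HolomorphicOn (SliceSet Λ i) h₃ ∧ CProp (SliceSet Λ i) h₃) ∧
      ∀ z ∈ SliceSet Λ i,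
        f (toSlice i z) =
          toSlice i (h₀ z) + toSlice i (h₁ z) * i
            + toSlice i (h₂ z) * j + toSlice i (h₃ z) * (i * j) := by
  have hΩ := hax.zInvariant_sliceSet hi
  obtain ⟨h₀, h₁, H₀, H₁, h01⟩ := HolomorphicOn.exists_cProp_add hΩ
    (hf.holomorphicOn_comp hs.1 hi (sliceComponent i) (sliceComponent_mul hi))
  obtain ⟨h₂, h₃, H₂, H₃, h23⟩ := HolomorphicOn.exists_cProp_add hΩ
    (hf.holomorphicOn_comp hs.1 hi
      (sliceComponent i ∘ₗ (-LinearMap.mulRight ℝ j)) fun q => by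
        simp [mul_assoc, ← mul_neg, sliceComponent_mul hi])
  refine ⟨h₀, h₁, h₂, h₃, H₀, H₁, H₂, H₃, fun z _ => ?_⟩
  have e := toSlice_sliceComponent_add hi hj hperp (f (toSlice i z))
  have h23' : sliceComponent i (-(f (toSlice i z) * j)) = h₂ z + I * h₃ z := by
    simpa using h23 z
  rw [h01 z, h23', toSlice_add, toSlice_add, toSlice_I_mul hi, toSlice_I_mul hi] at e
  rw [← e, add_mul, mul_assoc (toSlice i (h₃ z)), add_assoc _ (toSlice i (h₂ z) * j)]
end
end

section
/- Let Λ ⊆ ℍ be an axially symmetric s-domain, let 𝐢 ∈ 𝕊², and let Ω_𝐢 = {(x,y) ∈ ℝ² : x + y𝐢 ∈ Λ}. Let f : Λ → ℍ and K, B : Λ × Λ → ℍ satisfy: (i) conj(K(a,b)) = K(b,a) and conj(B(a,b)) = B(b,a) for all a, b ∈ Λ; (ii) f(q) = ∫_{Ω_𝐢} K(q, x + y𝐢)·f(x + y𝐢) dx dy for all q ∈ Λ; (iii) K(ζ, q) = ∫_Λ B(ζ, r)·K(r, q) dμ(r) for all q ∈ Λ and all ζ ∈ Λ ∩ ℂ(𝐢),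 where dμ is the 4-dimensional Lebesgue measure on ℍ ≅ ℝ⁴; (iv) for each q ∈ Λ the function (r, (x,y)) ↦ K(q,r)·B(r, x + y𝐢)·f(x + y𝐢) is Bochner integrable on Λ × Ω_𝐢. Define M_𝐢[f](r) := ∫_{Ω_𝐢} B(r, x + y𝐢)·f(x + y𝐢) dx dy. Then f(q) = ∫_Λ K(q, r)·M_𝐢[f](r) dμ(r) for every q ∈ Λ. -/
open MeasureTheory Complex Quaternion

noncomputable section

instance : MeasurableSpace ℍ[ℝ] := borel _
instance : BorelSpace ℍ[ℝ] := ⟨rfl⟩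
/-- The 4-dimensional Lebesgue measure on `ℍ ≅ ℝ⁴`. -/
instance : MeasureSpace ℍ[ℝ] := measureSpaceOfInnerProductSpace

/-- The embedding `ℝ² → ℂ(𝐢) ⊆ ℍ`, `(x, y) ↦ x + y𝐢`. -/
def sliceEmb (i : ℍ[ℝ]) (p : ℝ × ℝ) : ℍ[ℝ] := (p.1 : ℍ[ℝ]) + p.2 • i

theorem integral_mul_left_quaternion {α : Type*} [MeasurableSpace α] (μ : Measure α)
    (c : ℍ[ℝ]) (g : α → ℍ[ℝ]) : ∫ a, c * g a ∂μ = c * ∫ a, g a ∂μ :=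
  integral_smul c g

theorem integral_star_quaternion {α : Type*} [MeasurableSpace α] (μ : Measure α)
    (g : α → ℍ[ℝ]) : ∫ a, star (g a) ∂μ = star (∫ a, g a ∂μ) :=
  haveI : StarModule ℝ ℍ[ℝ] := ⟨fun r q => by simp⟩
  (starL' ℝ : ℍ[ℝ] ≃L[ℝ] ℍ[ℝ]).integral_comp_comm g

theorem integral_mul_right_quaternion {α : Type*} [MeasurableSpace α] (μ : Measure α)
    (c : ℍ[ℝ]) (g : α → ℍ[ℝ]) : ∫ a, g a * c ∂μ = (∫ a, g a ∂μ) * c := by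
  apply star_injective
  rw [← integral_star_quaternion]
  simp only [star_mul, integral_mul_left_quaternion, integral_star_quaternion]

theorem continuous_sliceEmb (i : ℍ[ℝ]) : Continuous (sliceEmb i) := by
  unfold sliceEmb
  exact (Quaternion.continuous_coe.comp continuous_fst).add (continuous_snd.smul continuous_const)

theorem stmt19 (Λ : Set ℍ[ℝ]) (hs : IsSDomain Λ) (hax : AxSymm Λ)
    (i : ℍ[ℝ]) (hi : i ∈ Sph)
    (Ω : Set (ℝ × ℝ)) (hΩ : Ω = {p : ℝ × ℝ | sliceEmb i p ∈ Λ})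
    (f : ℍ[ℝ] → ℍ[ℝ]) (K B : ℍ[ℝ] → ℍ[ℝ] → ℍ[ℝ])
    -- (i) `K` and `B` are hermitian
    (hKherm : ∀ a ∈ Λ, ∀ b ∈ Λ, star (K a b) = K b a)
    (hBherm : ∀ a ∈ Λ, ∀ b ∈ Λ, star (B a b) = B b a)
    -- (ii) `K` reproduces `f` by integration over the slice
    (hrepK : ∀ q ∈ Λ, f q = ∫ p in Ω, K q (sliceEmb i p) * f (sliceEmb i p))
    -- (iii) `B` reproduces `K(·, q)` by integration over `Λ`
    (hrepB : ∀ q ∈ Λ, ∀ ζ ∈ Λ ∩ CSlice i, K ζ q = ∫ r in Λ, B ζ r * K r q)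
    -- (iv) Bochner integrability on `Λ × Ω_𝐢`
    (hint : ∀ q ∈ Λ, Integrable
      (fun w : ℍ[ℝ] × (ℝ × ℝ) => K q w.1 * (B w.1 (sliceEmb i w.2) * f (sliceEmb i w.2)))
      ((volume.restrict Λ).prod (volume.restrict Ω)))
    (M : ℍ[ℝ] → ℍ[ℝ])
    (hM : ∀ r : ℍ[ℝ], M r = ∫ p in Ω, B r (sliceEmb i p) * f (sliceEmb i p)) :
    ∀ q ∈ Λ, f q = ∫ r in Λ, K q r * M r := by
  intro q hq
  have hΛm : MeasurableSet Λ := hs.1.measurableSet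
  have hΩm : MeasurableSet Ω := by
    rw [hΩ]
    exact (hs.1.preimage (continuous_sliceEmb i)).measurableSet
  have hslice : ∀ p ∈ Ω, K q (sliceEmb i p) * f (sliceEmb i p) =
      ∫ r in Λ, K q r * (B r (sliceEmb i p) * f (sliceEmb i p)) := by
    intro p hp
    have hpΛ : sliceEmb i p ∈ Λ := by
      rw [hΩ] at hp
      exact hp
    have hK : K q (sliceEmb i p) = ∫ r in Λ, K q r * B r (sliceEmb i p) := by
      rw [← hKherm _ hpΛ _ hq, hrepB q hq _ ⟨hpΛ, p.1, p.2, rfl⟩, ← integral_star_quaternion]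
      refine setIntegral_congr_fun hΛm fun r hr => ?_
      simp only [star_mul, hKherm r hr q hq, hBherm _ hpΛ r hr]
    rw [hK, ← integral_mul_right_quaternion]
    simp only [mul_assoc]
  rw [hrepK q hq, setIntegral_congr_fun hΩm hslice, ← integral_integral_swap (hint q hq)]
  simp only [integral_mul_left_quaternion, hM]
end
end
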